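/- arXiv:2406.03264 — 6 statements merged into one kernel-verified Lean document; each statement's English description precedes it below -/
import Mathlib

section
/- Let X be a type, let f, g, μf, σf, μg, σg : ℝ × X → ℝ with σf, σg nonnegative, and let βf, βg > 0, h ∈ ℝ, Lf ≥ 0, L' > 0. Assume confidence validity everywhere: for all z, |μf(z) − f(z)| ≤ βf·σf(z) and |μg(z) − g(z)| ≤ βg·σg(z). Let s⋆, s₁, s₂, ŝ, s̄, s_t ∈ ℝ and x⋆, x_t ∈ X, and set M = max(βg·σg(s_t,x_t), βf·σf(s_t,x_t)). Suppose: (a) g(s⋆,x⋆) ≤ h; (b) g(s⋆,x⋆) − g(s₁,x⋆) ≥ L'·|s⋆ − s₁|; (c) μg(s₁,x⋆) + βg·σg(s₁,x⋆) ≥ h; (d) f(s⋆,x⋆) − f(s₁,x⋆) ≤ Lf·|s⋆ − s₁|; (e) μg(s₂,x_t) + βg·σg(s₂,x_t) ≥ h and μg(s₂,x_t) − βg·σg(s₂,x_t) + L'·|s̄ − s₂| ≤ h; (f) μf(ŝ,x_t) + βf·σf(ŝ,x_t) ≥ μf(s₂,x_t) + βf·σf(s₂,x_t); (g) either [s_t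 = ŝ and (μf(ŝ,x_t) + βf·σf(ŝ,x_t) ≥ μf(s₁,x⋆) − βf·σf(s₁,x⋆) or μf(s₂,x_t) + βf·σf(s₂,x_t) + Lf·|s̄ − s₂| ≥ μf(s₁,x⋆) − βf·σf(s₁,x⋆))] or [s_t = s₂ and μf(s₂,x_t) + βf·σf(s₂,x_t) + Lf·|s̄ − s₂| ≥ μf(s₁,x⋆) − βf·σf(s₁,x⋆)]; (h) M ≥ βg·σg(s₁,x⋆), M ≥ βf·σf(s₁,x⋆), M ≥ βf·σf(ŝ,x_t), M ≥ βf·σf(s₂,x_t), and M ≥ βg·σg(s₂,x_t). Then f(s⋆,x⋆) − f(s_t,x_t) ≤ (8 + 6·Lf/L')·M. -/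
/-- Instantaneous regret bound for M-SafeOpt (Case 1) when the safe optimum is not
yet in the known safe set (eqn. 56). -/
theorem stmt_6 {X : Type*} (f g μf σf μg σg : ℝ × X → ℝ)
    (hσf : ∀ z, 0 ≤ σf z) (hσg : ∀ z, 0 ≤ σg z)
    (βf βg h Lf L' : ℝ)
    (hβf : 0 < βf) (hβg : 0 < βg) (hLf : 0 ≤ Lf) (hL' : 0 < L')
    (hconf_f : ∀ z, |μf z - f z| ≤ βf * σf z)
    (hconf_g : ∀ z, |μg z - g z| ≤ βg * σg z)
    (sStar s1 s2 sHat sBar st : ℝ) (xStar xt : X)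
    (M : ℝ)
    (hM : M = max (βg * σg (st, xt)) (βf * σf (st, xt)))
    (ha : g (sStar, xStar) ≤ h)
    (hb : g (sStar, xStar) - g (s1, xStar) ≥ L' * |sStar - s1|)
    (hc : μg (s1, xStar) + βg * σg (s1, xStar) ≥ h)
    (hd : f (sStar, xStar) - f (s1, xStar) ≤ Lf * |sStar - s1|)
    (he1 : μg (s2, xt) + βg * σg (s2, xt) ≥ h)
    (he2 : μg (s2, xt) - βg * σg (s2, xt) + L' * |sBar - s2| ≤ h)
    (hf : μf (sHat, xt) + βf * σf (sHat, xt) ≥ μf (s2, xt) + βf * σf (s2, xt))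
    (hg : (st = sHat ∧
            (μf (sHat, xt) + βf * σf (sHat, xt) ≥ μf (s1, xStar) - βf * σf (s1, xStar) ∨
             μf (s2, xt) + βf * σf (s2, xt) + Lf * |sBar - s2| ≥
               μf (s1, xStar) - βf * σf (s1, xStar))) ∨
          (st = s2 ∧
            μf (s2, xt) + βf * σf (s2, xt) + Lf * |sBar - s2| ≥
              μf (s1, xStar) - βf * σf (s1, xStar)))
    (hh1 : M ≥ βg * σg (s1, xStar))
    (hh2 : M ≥ βf * σf (s1, xStar))
    (hh3 : M ≥ βf * σf (sHat, xt))
    (hh4 : M ≥ βf * σf (s2, xt))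
    (hh5 : M ≥ βg * σg (s2, xt)) :
    f (sStar, xStar) - f (st, xt) ≤ (8 + 6 * Lf / L') * M := by
  have g1 := abs_le.mp (hconf_g (s1, xStar))
  have f1 := abs_le.mp (hconf_f (s1, xStar))
  have f2 := abs_le.mp (hconf_f (s2, xt))
  have f3 := abs_le.mp (hconf_f (sHat, xt))
  have hM0 : 0 ≤ M := le_trans (mul_nonneg hβf.le (hσf _)) hh2
  have key : ∀ a : ℝ, L' * a ≤ 2 * M → Lf * a ≤ 2 * (Lf / L' * M) := by
    intro a ha
    have h1 : Lf / L' * (L' * a) ≤ Lf / L' * (2 * M) :=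
      mul_le_mul_of_nonneg_left ha (div_nonneg hLf hL'.le)
    have h2 : Lf / L' * (L' * a) = Lf * a := by field_simp
    linarith
  have k1 := key |sStar - s1| (by linarith)
  have k2 := key |sBar - s2| (by linarith)
  have hK : 0 ≤ Lf / L' * M := mul_nonneg (div_nonneg hLf hL'.le) hM0
  have e : (8 + 6 * Lf / L') * M = 8 * M + 6 * (Lf / L' * M) := by ring
  rw [e]
  rcases hg with ⟨rfl, hg | hg⟩ | ⟨rfl, hg⟩ <;> linarith
end

section
/- Let X be a type, let f, g, μf, σf, μg, σg : ℝ × X → ℝ with σf, σg nonnegative, and let βf, βg > 0, h ∈ ℝ, Lf ≥ 0, L' > 0. Assume confidence validity everywhere: for all z, |μf(z) − f(z)| ≤ βf·σf(z) and |μg(z) − g(z)| ≤ βg·σg(z). Let s⋆, ŝ₁, s̄, s_t ∈ ℝ and x⋆, x_t ∈ X, and set M = max(βg·σg(s_t,x_t), βf·σf(s_t,x_t)). Suppose: (a) μf(s⋆,x⋆) + βf·σf(s⋆,x⋆) ≤ μf(ŝ₁,x⋆) + βf·σf(ŝ₁,x⋆); (b) either μf(ŝ₁,x⋆) − βf·σf(ŝ₁,x⋆)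 ≤ μf(s_t,x_t) + βf·σf(s_t,x_t), or [μf(ŝ₁,x⋆) − βf·σf(ŝ₁,x⋆) ≤ μf(s_t,x_t) + βf·σf(s_t,x_t) + Lf·|s̄ − s_t| and μg(s_t,x_t) + βg·σg(s_t,x_t) ≥ h and μg(s_t,x_t) − βg·σg(s_t,x_t) + L'·|s̄ − s_t| ≤ h]; (c) M ≥ βf·σf(ŝ₁,x⋆). Then f(s⋆,x⋆) − f(s_t,x_t) ≤ (4 + 2·Lf/L')·M. -/
/-- Instantaneous regret bound for M-SafeOpt (Case 1) when the safe optimum is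
already in the known safe set (eqn. 65). -/
theorem stmt_7 {X : Type*} (f g μf σf μg σg : ℝ × X → ℝ)
    (hσf : ∀ z, 0 ≤ σf z) (hσg : ∀ z, 0 ≤ σg z)
    (βf βg h Lf L' : ℝ)
    (hβf : 0 < βf) (hβg : 0 < βg) (hLf : 0 ≤ Lf) (hL' : 0 < L')
    (hconf_f : ∀ z, |μf z - f z| ≤ βf * σf z)
    (hconf_g : ∀ z, |μg z - g z| ≤ βg * σg z)
    (sStar sHat1 sBar st : ℝ) (xStar xt : X)
    (M : ℝ)
    (hM : M = max (βg * σg (st, xt)) (βf * σf (st, xt)))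
    (ha : μf (sStar, xStar) + βf * σf (sStar, xStar) ≤
            μf (sHat1, xStar) + βf * σf (sHat1, xStar))
    (hb : μf (sHat1, xStar) - βf * σf (sHat1, xStar) ≤
            μf (st, xt) + βf * σf (st, xt) ∨
          (μf (sHat1, xStar) - βf * σf (sHat1, xStar) ≤
             μf (st, xt) + βf * σf (st, xt) + Lf * |sBar - st| ∧
           μg (st, xt) + βg * σg (st, xt) ≥ h ∧
           μg (st, xt) - βg * σg (st, xt) + L' * |sBar - st| ≤ h))
    (hc : M ≥ βf * σf (sHat1, xStar)) :
    f (sStar, xStar) - f (st, xt) ≤ (4 + 2 * Lf / L') * M := by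
  have h1 := (abs_le.mp (hconf_f (sStar, xStar))).1
  have h2 := (abs_le.mp (hconf_f (st, xt))).2
  have h3 : βg * σg (st, xt) ≤ M := hM ▸ le_max_left _ _
  have h4 : βf * σf (st, xt) ≤ M := hM ▸ le_max_right _ _
  have hM0 : 0 ≤ M := le_trans (mul_nonneg hβf.le (hσf _)) h4
  have e : (4 + 2 * Lf / L') * M = 4 * M + Lf * (2 * M / L') := by ring
  rw [e]
  rcases hb with hb | ⟨hb, hg1, hg2⟩
  · have : 0 ≤ Lf * (2 * M / L') := by positivity
    linarith
  · have hd : |sBar - st| ≤ 2 * M / L' := by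
      rw [le_div_iff₀ hL']
      linarith
    have := mul_le_mul_of_nonneg_left hd hLf
    linarith
end

section
/- Let X be a type, let f, g, μf, σf, μg, σg : ℝ × X → ℝ with σf, σg nonnegative, and let βf, βg > 0, h ∈ ℝ, Lf ≥ 0, L' > 0. Assume confidence validity everywhere: for all z, |μf(z) − f(z)| ≤ βf·σf(z) and |μg(z) − g(z)| ≤ βg·σg(z). Let s⋆, s₁, s̄, s_t ∈ ℝ and x⋆, x_t ∈ X, and set M = max(βg·σg(s_t,x_t), βf·σf(s_t,x_t)). Suppose: (a) g(s⋆,x⋆) ≤ h; (b) g(s⋆,x⋆) − g(s₁,x⋆) ≥ L'·|s⋆ − s₁|; (c) μg(s₁,x⋆) + βg·σg(s₁,x⋆) ≥ h; (d) f(s⋆,x⋆) − f(s₁,x⋆) ≤ Lf·|s⋆ − s₁|; (e) μf(s_t,x_t) + βf·σf(s_t,x_t) + Lf·|s̄ − s_t| ≥ μf(s₁,x⋆) − βf·σf(s₁,x⋆); (f) μg(s_t,x_t) + βg·σg(s_t,x_t) ≥ h and μg(s_t,x_t) − βg·σg(s_t,x_t) + L'·|s̄ − s_t| ≤ h; (g)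 M ≥ βg·σg(s₁,x⋆) and M ≥ βf·σf(s₁,x⋆). Then f(s⋆,x⋆) − f(s_t,x_t) ≤ (4 + 4·Lf/L')·M. -/
/-- Instantaneous regret bound for simplified M-SafeOpt in Case 3 when the safe
optimum is not yet in the known safe set (eqn. 70). -/
theorem stmt_9 {X : Type*} (f g μf σf μg σg : ℝ × X → ℝ)
    (hσf : ∀ z, 0 ≤ σf z) (hσg : ∀ z, 0 ≤ σg z)
    (βf βg h Lf L' : ℝ)
    (hβf : 0 < βf) (hβg : 0 < βg) (hLf : 0 ≤ Lf) (hL' : 0 < L')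
    (hconf_f : ∀ z, |μf z - f z| ≤ βf * σf z)
    (hconf_g : ∀ z, |μg z - g z| ≤ βg * σg z)
    (sStar s1 sBar st : ℝ) (xStar xt : X)
    (M : ℝ)
    (hM : M = max (βg * σg (st, xt)) (βf * σf (st, xt)))
    (ha : g (sStar, xStar) ≤ h)
    (hb : g (sStar, xStar) - g (s1, xStar) ≥ L' * |sStar - s1|)
    (hc : μg (s1, xStar) + βg * σg (s1, xStar) ≥ h)
    (hd : f (sStar, xStar) - f (s1, xStar) ≤ Lf * |sStar - s1|)
    (he : μf (st, xt) + βf * σf (st, xt) + Lf * |sBar - st| ≥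
            μf (s1, xStar) - βf * σf (s1, xStar))
    (hf1 : μg (st, xt) + βg * σg (st, xt) ≥ h)
    (hf2 : μg (st, xt) - βg * σg (st, xt) + L' * |sBar - st| ≤ h)
    (hg1 : M ≥ βg * σg (s1, xStar))
    (hg2 : M ≥ βf * σf (s1, xStar)) :
    f (sStar, xStar) - f (st, xt) ≤ (4 + 4 * Lf / L') * M := by
  have m1 : βg * σg (st, xt) ≤ M := hM ▸ le_max_left _ _
  have m2 : βf * σf (st, xt) ≤ M := hM ▸ le_max_right _ _
  have c1 := abs_le.mp (hconf_f (s1, xStar))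
  have c2 := abs_le.mp (hconf_f (st, xt))
  have c3 := abs_le.mp (hconf_g (s1, xStar))
  have d1 : |sStar - s1| ≤ 2 * M / L' := by
    rw [le_div_iff₀ hL']
    linarith [c3.1, c3.2]
  have d2 : |sBar - st| ≤ 2 * M / L' := by
    rw [le_div_iff₀ hL']
    linarith
  have e1 := mul_le_mul_of_nonneg_left d1 hLf
  have e2 := mul_le_mul_of_nonneg_left d2 hLf
  have e3 : (4 + 4 * Lf / L') * M = 4 * M + Lf * (2 * M / L') + Lf * (2 * M / L') := by
    ring
  rw [e3]
  linarith [c1.1, c1.2, c2.1, c2.2]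
end

section
/- Let f, g : ℝ → ℝ, and let h, βf, βg, Lf, L', s⋆, s_b, ŝ, s_t ∈ ℝ with βf, βg > 0, Lf ≥ 0, L' > 0. Let μf, σf, μg, σg : ℝ → ℝ with σf, σg nonnegative, and assume |μf(s) − f(s)| ≤ βf·σf(s) and |μg(s) − g(s)| ≤ βg·σg(s) for all s. Let M = max(βg·σg(s_t), βf·σf(s_t)). Suppose: (a) g(s⋆) ≤ h; (b) g(s⋆) − g(s_b) ≥ L'·|s⋆ − s_b|; (c) μg(s_b) + βg·σg(s_b) ≥ h; (d) f(s⋆) − f(s_b) ≤ Lf·|s⋆ − s_b|; (e) μf(ŝ) + βf·σf(ŝ) ≥ μf(s_b) + βf·σf(s_b); (f) s_t = s_b or s_t = ŝ; (g) M ≥ βg·σg(s_b) and M ≥ βf·σf(ŝ). Then f(s⋆) − f(s_t) ≤ (2 + 2·Lf/L')·M. -/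
/-- Instantaneous regret bound for M-SafeOpt in Case 2 when the per-x safe optimum
is not yet in the known safe set (eqns. 76-78). -/
theorem stmt_11 (f g : ℝ → ℝ) (h βf βg Lf L' sStar sb sHat st : ℝ)
    (hβf : 0 < βf) (hβg : 0 < βg) (hLf : 0 ≤ Lf) (hL' : 0 < L')
    (μf σf μg σg : ℝ → ℝ)
    (hσf : ∀ s, 0 ≤ σf s) (hσg : ∀ s, 0 ≤ σg s)
    (hconf_f : ∀ s, |μf s - f s| ≤ βf * σf s)
    (hconf_g : ∀ s, |μg s - g s| ≤ βg * σg s)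
    (M : ℝ) (hM : M = max (βg * σg st) (βf * σf st))
    (ha : g sStar ≤ h)
    (hb : g sStar - g sb ≥ L' * |sStar - sb|)
    (hc : μg sb + βg * σg sb ≥ h)
    (hd : f sStar - f sb ≤ Lf * |sStar - sb|)
    (he : μf sHat + βf * σf sHat ≥ μf sb + βf * σf sb)
    (hf : st = sb ∨ st = sHat)
    (hg1 : M ≥ βg * σg sb)
    (hg2 : M ≥ βf * σf sHat) :
    f sStar - f st ≤ (2 + 2 * Lf / L') * M := by
  have h1 := abs_le.mp (hconf_g sb)
  have h2 := abs_le.mp (hconf_f sb)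
  have h3 := abs_le.mp (hconf_f sHat)
  have hM0 : 0 ≤ M := le_trans (mul_nonneg hβg.le (hσg sb)) hg1
  have hdist : |sStar - sb| ≤ 2 * M / L' := by
    rw [le_div_iff₀ hL']
    linarith [h1.1, h1.2, mul_comm L' |sStar - sb|]
  have h4 : Lf * |sStar - sb| ≤ Lf * (2 * M / L') := mul_le_mul_of_nonneg_left hdist hLf
  have h5 : (2 + 2 * Lf / L') * M = 2 * M + Lf * (2 * M / L') := by ring
  rw [h5]
  rcases hf with rfl | rfl
  · linarith
  · linarith [h2.1, h2.2, h3.1, h3.2]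
end

section
/- Let f : ℝ → ℝ, and let βf, βg, Lf, L', h, s⋆, s_b, ŝ, s_t, s̄ ∈ ℝ with βf, βg > 0, Lf ≥ 0, L' > 0. Let μf, σf, μg, σg : ℝ → ℝ with σf, σg nonnegative, and assume |μf(s) − f(s)| ≤ βf·σf(s) for all s. Let M = max(βg·σg(s_t), βf·σf(s_t)). Suppose: (a) μf(s⋆) + βf·σf(s⋆) ≤ μf(ŝ) + βf·σf(ŝ); (b) either s_t = ŝ, or [s_t = s_b and μf(s_b) + βf·σf(s_b) + Lf·|s̄ − s_b| ≥ μf(s⋆) − βf·σf(s⋆) and μg(s_b) + βg·σg(s_b) ≥ h and μg(s_b) − βg·σg(s_b) + L'·|s̄ − s_b| ≤ h]; (c) M ≥ βf·σf(ŝ) and M ≥ βf·σf(s⋆). Then f(s⋆) − f(s_t) ≤ (4 + 2·Lf/L')·M. -/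
/-- Instantaneous regret bound for M-SafeOpt in Case 2 when the per-x safe optimum
is already in the known safe set (eqns. 80-86). -/
theorem stmt_12 (f : ℝ → ℝ) (βf βg Lf L' h sStar sb sHat st sBar : ℝ)
    (hβf : 0 < βf) (hβg : 0 < βg) (hLf : 0 ≤ Lf) (hL' : 0 < L')
    (μf σf μg σg : ℝ → ℝ)
    (hσf : ∀ s, 0 ≤ σf s) (hσg : ∀ s, 0 ≤ σg s)
    (hconf_f : ∀ s, |μf s - f s| ≤ βf * σf s)
    (M : ℝ) (hM : M = max (βg * σg st) (βf * σf st))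
    (ha : μf sStar + βf * σf sStar ≤ μf sHat + βf * σf sHat)
    (hb : st = sHat ∨
          (st = sb ∧
           μf sb + βf * σf sb + Lf * |sBar - sb| ≥ μf sStar - βf * σf sStar ∧
           μg sb + βg * σg sb ≥ h ∧
           μg sb - βg * σg sb + L' * |sBar - sb| ≤ h))
    (hc1 : M ≥ βf * σf sHat)
    (hc2 : M ≥ βf * σf sStar) :
    f sStar - f st ≤ (4 + 2 * Lf / L') * M := by
  have h1 : βg * σg st ≤ M := hM ▸ le_max_left _ _
  have h2 : βf * σf st ≤ M := hM ▸ le_max_right _ _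
  have hM0 : 0 ≤ M := le_trans (mul_nonneg hβf.le (hσf st)) h2
  have e1 := abs_le.mp (hconf_f sStar)
  have e2 := abs_le.mp (hconf_f st)
  have hr : 0 ≤ Lf / L' := div_nonneg hLf hL'.le
  have hexp : (4 + 2 * Lf / L') * M = 4 * M + Lf / L' * (2 * M) := by ring
  rw [hexp]
  rcases hb with rfl | ⟨rfl, b1, b2, b3⟩
  · have := mul_nonneg hr (by linarith : 0 ≤ 2 * M)
    linarith [e1.1, e2.2]
  · have hd : L' * |sBar - st| ≤ 2 * M := by linarith
    have h3 := mul_le_mul_of_nonneg_left hd hr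
    have h4 : Lf / L' * (L' * |sBar - st|) = Lf * |sBar - st| := by
      field_simp
    linarith [e1.1, e2.2]
end

section
/- Let f, g : ℝ → ℝ, and let h, βf, βg, Lf, L', s⋆, s_b, ŝ ∈ ℝ with βf, βg > 0, Lf ≥ 0, L' > 0. Let μf, σf, μg, σg : ℝ → ℝ with σf, σg nonnegative, and assume |μf(s) − f(s)| ≤ βf·σf(s) and |μg(s) − g(s)| ≤ βg·σg(s) for all s. Suppose: (a) g(s⋆) ≤ h; (b) g(s⋆) − g(s_b) ≥ L'·|s⋆ − s_b|; (c) μg(s_b) + βg·σg(s_b) ≥ h; (d) f(s⋆) − f(s_b) ≤ Lf·|s⋆ − s_b|; (e) μf(ŝ) + βf·σf(ŝ) ≥ μf(s_b) + βf·σf(s_b). Then f(s⋆) − f(ŝ) ≤ 2·(Lf/L')·βg·σg(s_b) + 2·βf·σf(ŝ). -/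
/-- Worst-case simple regret bound for M-SafeOpt in Case 2 (Theorem 3) when the
per-x safe optimum is not yet in the known safe set (eqns. 90-95). -/
theorem stmt_13 (f g : ℝ → ℝ) (h βf βg Lf L' sStar sb sHat : ℝ)
    (hβf : 0 < βf) (hβg : 0 < βg) (hLf : 0 ≤ Lf) (hL' : 0 < L')
    (μf σf μg σg : ℝ → ℝ)
    (hσf : ∀ s, 0 ≤ σf s) (hσg : ∀ s, 0 ≤ σg s)
    (hconf_f : ∀ s, |μf s - f s| ≤ βf * σf s)
    (hconf_g : ∀ s, |μg s - g s| ≤ βg * σg s)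
    (ha : g sStar ≤ h)
    (hb : g sStar - g sb ≥ L' * |sStar - sb|)
    (hc : μg sb + βg * σg sb ≥ h)
    (hd : f sStar - f sb ≤ Lf * |sStar - sb|)
    (he : μf sHat + βf * σf sHat ≥ μf sb + βf * σf sb) :
    f sStar - f sHat ≤ 2 * (Lf / L') * βg * σg sb + 2 * βf * σf sHat := by
  have h1 := abs_le.mp (hconf_g sb)
  have h2 := abs_le.mp (hconf_f sb)
  have h3 := abs_le.mp (hconf_f sHat)
  have h4 : |sStar - sb| ≤ 2 * (βg * σg sb) / L' := by
    rw [le_div_iff₀ hL']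
    linarith [h1.2]
  have h5 := mul_le_mul_of_nonneg_left h4 hLf
  have h6 : Lf * (2 * (βg * σg sb) / L') = 2 * (Lf / L') * βg * σg sb := by ring
  linarith [h2.1, h3.2]
end
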